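/- For every integer b ≥ 4, there is a constant C_b > 0 such that for every integer x ≥ 2, the number of base-b Keith numbers in the interval [1, x] is at most C_b·x/√(log x). -/

import Mathlib

/-- `keithList a m` is the list of the first `m` terms `K^N_1, …, K^N_m` of the Keith
sequence associated with the digit string `a = [a_1, …, a_n]` (most significant first):
`K^N_m = a_m` for `1 ≤ m ≤ n` and `K^N_m = K^N_{m-1} + ⋯ + K^N_{m-n}` for `m > n`. -/
def keithList (a : List ℕ) : ℕ → List ℕ
  | 0 => []
  | m + 1 =>
      let prev := keithList a m
      prev ++ [if m < a.length then a.getD m 0 else (prev.drop (m - a.length)).sum]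

/-- `keithSeq a m = K^N_m` (1-indexed; `keithSeq a 0 = 0` by convention). -/
def keithSeq (a : List ℕ) (m : ℕ) : ℕ := (keithList a m).getD (m - 1) 0

/-- A base-b Keith number: a positive integer with at least 2 base-b digits that occurs
in the Keith sequence generated by its own base-b digits (most significant first). -/
def IsKeithBase (b N : ℕ) : Prop :=
  2 ≤ (Nat.digits b N).length ∧
    ∃ m, 1 ≤ m ∧ keithSeq ((Nat.digits b N).reverse) m = N

open Finset

/-! ### The Keith sequence as a solution of the `n`-bonacci recurrence -/

/-- Each term of `f` from index `n` on is the sum of the `n` preceding ones. -/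
def IsNacci (n : ℕ) (f : ℕ → ℕ) : Prop :=
  ∀ m, f (m + n) = ∑ j ∈ range n, f (m + j)

theorem keithList_length (a : List ℕ) (m : ℕ) : (keithList a m).length = m := by
  induction m with
  | zero => simp [keithList]
  | succ m ih => simp [keithList, ih]

theorem keithSeq_succ (a : List ℕ) (m : ℕ) :
    keithSeq a (m + 1) =
      if m < a.length then a.getD m 0 else ((keithList a m).drop (m - a.length)).sum := by
  simp [keithSeq, keithList, List.getD_eq_getElem?_getD, keithList_length]

theorem keithList_eq_map (a : List ℕ) (m : ℕ) :
    keithList a m = (List.range m).map fun j => keithSeq a (j + 1) := by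
  induction m with
  | zero => simp [keithList]
  | succ m ih =>
    rw [List.range_succ, List.map_append, ← ih, List.map_singleton, keithSeq_succ]
    rfl

theorem isNacci_keithSeq (a : List ℕ) : IsNacci a.length fun m => keithSeq a (m + 1) := by
  intro m
  simp only [keithSeq_succ a (m + a.length), keithList_eq_map, List.range_add, List.map_append,
    Nat.add_sub_cancel, not_lt.2 (Nat.le_add_left _ m), if_false]
  rw [List.drop_left' (by simp), List.map_map]
  simp [Finset.sum, Finset.range, Multiset.range, Function.comp_def]

namespace IsNacci

variable {n : ℕ} {f g : ℕ → ℕ}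

theorem ext (hf : IsNacci n f) (hg : IsNacci n g) (h : ∀ i < n, f i = g i) : f = g := by
  funext m
  induction m using Nat.strong_induction_on with
  | _ m ih =>
    rcases lt_or_ge m n with hm | hm
    · exact h m hm
    · obtain ⟨p, rfl⟩ := Nat.exists_eq_add_of_le' hm
      rw [hf, hg]
      refine sum_congr rfl fun j hj => ih _ ?_
      have := mem_range.1 hj
      omega

theorem sum {ι : Type*} {s : Finset ι} {F : ι → ℕ → ℕ} (c : ι → ℕ)
    (h : ∀ i ∈ s, IsNacci n (F i)) : IsNacci n fun m => ∑ i ∈ s, c i * F i m := by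
  intro m
  simp only
  rw [sum_comm]
  refine sum_congr rfl fun i hi => ?_
  rw [h i hi, mul_sum]

theorem shift (hf : IsNacci n f) : IsNacci n fun m => f (m + 1) := by
  intro m
  have := hf (m + 1)
  simp only [add_right_comm m _ 1]
  exact this

theorem add_eq_two_mul (hf : IsNacci n f) (m : ℕ) : f (m + n + 1) + f m = 2 * f (m + n) := by
  have h1 := hf (m + 1)
  have h2 := hf m
  have h3 := sum_range_succ' (fun j => f (m + j)) n
  have h4 := sum_range_succ (fun j => f (m + j)) n
  simp only [add_zero] at h3
  have h5 : ∑ j ∈ range n, f (m + 1 + j) = ∑ j ∈ range n, f (m + (j + 1)) :=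
    sum_congr rfl fun j _ => by congr 1; ring
  have h6 : f (m + n + 1) = f (m + 1 + n) := by congr 1; ring
  omega

theorem le_succ (hf : IsNacci n f) (hn : 2 ≤ n) {m : ℕ} (hm : n ≤ m) : f m ≤ f (m + 1) := by
  obtain ⟨k, rfl⟩ := Nat.exists_eq_add_of_le' hn
  obtain ⟨p, rfl⟩ := Nat.exists_eq_add_of_le' hm
  have h := hf (p + 1)
  rw [sum_range_succ] at h
  have e1 : p + 1 + (k + 2) = p + (k + 2) + 1 := by ring
  have e2 : p + 1 + (k + 1) = p + (k + 2) := by ring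
  rw [e1, e2] at h
  omega

theorem two_mul_le (hf : IsNacci n f) (hn : 2 ≤ n) {m : ℕ} (hm : n ≤ m) :
    2 * f m ≤ f (m + 2) := by
  have h0 := hf.le_succ hn hm
  obtain ⟨k, rfl⟩ := Nat.exists_eq_add_of_le' hn
  obtain ⟨p, rfl⟩ := Nat.exists_eq_add_of_le' hm
  have h := hf (p + 2)
  rw [sum_range_succ, sum_range_succ] at h
  have e1 : p + 2 + (k + 2) = p + (k + 2) + 2 := by ring
  have e2 : p + 2 + (k + 1) = p + (k + 2) + 1 := by ring
  have e3 : p + 2 + k = p + (k + 2) := by ring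
  rw [e1, e2, e3] at h
  omega

theorem two_pow_mul_le (hf : IsNacci n f) (hn : 2 ≤ n) {m : ℕ} (hm : n ≤ m) (t : ℕ) :
    2 ^ t * f m ≤ f (m + 2 * t) := by
  induction t with
  | zero => simp
  | succ t ih =>
    have := hf.two_mul_le hn (m := m + 2 * t) (by omega)
    rw [pow_succ]
    have e : m + 2 * (t + 1) = m + 2 * t + 2 := by ring
    rw [e]
    linarith

theorem le_of_le (hf : IsNacci n f) (hn : 2 ≤ n) {m k : ℕ} (hm : n ≤ m) (hk : m ≤ k) :
    f m ≤ f k := by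
  induction k, hk using Nat.le_induction with
  | base => exact le_rfl
  | succ k hk ih => exact ih.trans (hf.le_succ hn (hm.trans hk))

/-- Domination of all tail sums of the initial values propagates to all later terms. -/
theorem le_of_sum_Ico_le (hf : IsNacci n f) (hg : IsNacci n g)
    (h : ∀ p ≤ n, ∑ i ∈ Ico p n, f i ≤ ∑ i ∈ Ico p n, g i) {m : ℕ} (hm : n ≤ m) :
    f m ≤ g m := by
  induction m using Nat.strong_induction_on with
  | _ m ih =>
    obtain ⟨p, rfl⟩ := Nat.exists_eq_add_of_le' hm
    have key : ∀ u : ℕ → ℕ, ∑ j ∈ range n, u (p + j) = ∑ i ∈ Ico p (p + n), u i := fun u => by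
      rw [sum_Ico_eq_sum_range, Nat.add_sub_cancel_left]
    rw [hf, hg, key, key]
    rcases le_total p n with hp | hp
    · rw [← sum_Ico_consecutive f hp hm, ← sum_Ico_consecutive g hp hm]
      refine add_le_add (h p hp) (sum_le_sum fun i hi => ?_)
      have := mem_Ico.1 hi
      exact ih i this.2 this.1
    · refine sum_le_sum fun i hi => ?_
      have := mem_Ico.1 hi
      exact ih i this.2 (hp.trans this.1)

end IsNacci

/-- The `n`-bonacci sequence whose initial values vanish except for a `1` at index `i`. -/
def nacciBasis (n i m : ℕ) : ℕ :=
  keithSeq ((List.range n).map fun j => if j = i then 1 else 0) (m + 1)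

theorem isNacci_nacciBasis (n i : ℕ) : IsNacci n (nacciBasis n i) := by
  have h := isNacci_keithSeq ((List.range n).map fun j => if j = i then 1 else 0)
  simp only [List.length_map, List.length_range] at h
  exact h

theorem nacciBasis_of_lt {n i m : ℕ} (hm : m < n) :
    nacciBasis n i m = if m = i then 1 else 0 := by
  simp [nacciBasis, keithSeq_succ, hm, List.getD_eq_getElem?_getD]

theorem keithSeq_eq_sum (a : List ℕ) (m : ℕ) :
    keithSeq a (m + 1) =
      ∑ i : Fin a.length, a.getD i 0 * nacciBasis a.length i m := by
  refine congrFun ((isNacci_keithSeq a).ext (IsNacci.sum (s := univ)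
    (F := fun i : Fin a.length => nacciBasis a.length i) (fun i => a.getD i 0)
    (fun i _ => isNacci_nacciBasis a.length i)) fun i hi => ?_) m
  simp only [keithSeq_succ, hi, if_true, nacciBasis_of_lt hi]
  rw [Finset.sum_eq_single ⟨i, hi⟩]
  · simp
  · intro j _ hj
    have : i ≠ j := fun h => hj (Fin.ext h.symm)
    simp [this]
  · simp

theorem nacciBasis_mono {n i j m : ℕ} (hij : i ≤ j) (hj : j < n) (hm : n ≤ m) :
    nacciBasis n i m ≤ nacciBasis n j m := by
  refine (isNacci_nacciBasis n i).le_of_sum_Ico_le (isNacci_nacciBasis n j) (fun p hp => ?_) hm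
  have key : ∀ k, ∑ x ∈ Ico p n, nacciBasis n k x = ∑ x ∈ Ico p n, if x = k then 1 else 0 :=
    fun k => sum_congr rfl fun x hx => nacciBasis_of_lt (mem_Ico.1 hx).2
  rw [key, key, sum_ite_eq', sum_ite_eq']
  simp only [mem_Ico]
  split_ifs <;> omega

theorem nacciBasis_pred {n : ℕ} (hn : 2 ≤ n) (m : ℕ) :
    nacciBasis n (n - 1) m = nacciBasis n 0 (m + 1) := by
  refine congrFun ((isNacci_nacciBasis n (n - 1)).ext (isNacci_nacciBasis n 0).shift
    fun i hi => ?_) m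
  rw [nacciBasis_of_lt hi]
  rcases lt_or_ge (i + 1) n with h | h
  · rw [nacciBasis_of_lt h, if_neg (by omega), if_neg (by omega)]
  · have h0 := isNacci_nacciBasis n 0 0
    rw [if_pos (by omega), show i + 1 = 0 + n by omega, h0,
      sum_congr rfl fun x hx => by rw [zero_add, nacciBasis_of_lt (mem_range.1 hx)]]
    simp
    omega

theorem nacciBasis_le_two_mul {n i m : ℕ} (hn : 2 ≤ n) (hi : i < n) (hm : n ≤ m) :
    nacciBasis n i m ≤ 2 * nacciBasis n 0 m := by
  refine (nacciBasis_mono (Nat.le_sub_one_of_lt hi) (by omega) hm).trans ?_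
  rw [nacciBasis_pred hn]
  obtain ⟨p, rfl⟩ := Nat.exists_eq_add_of_le' hm
  have := (isNacci_nacciBasis n 0).add_eq_two_mul p
  omega

/-! ### The Littlewood–Offord problem for digit strings -/

theorem centralBinom_sq_mul_le (k : ℕ) : k.centralBinom ^ 2 * (2 * k + 1) ≤ 16 ^ k := by
  induction k with
  | zero => simp
  | succ k ih =>
    have h := Nat.succ_mul_centralBinom_succ k
    refine le_of_mul_le_mul_left ?_ (show 0 < (k + 1) ^ 2 by positivity)
    calc (k + 1) ^ 2 * ((k + 1).centralBinom ^ 2 * (2 * (k + 1) + 1))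
        = ((k + 1) * (k + 1).centralBinom) ^ 2 * (2 * k + 3) := by ring
      _ = (k.centralBinom ^ 2 * (2 * k + 1)) * (4 * (2 * k + 1) * (2 * k + 3)) := by rw [h]; ring
      _ ≤ 16 ^ k * (16 * (k + 1) ^ 2) := Nat.mul_le_mul ih (by nlinarith)
      _ = (k + 1) ^ 2 * 16 ^ (k + 1) := by ring

theorem choose_half_sq_mul_le (k : ℕ) : (k.choose (k / 2)) ^ 2 * (k + 1) ≤ 4 ^ k := by
  obtain ⟨j, rfl | rfl⟩ := Nat.even_or_odd' k
  · rw [Nat.mul_div_cancel_left _ two_pos, pow_mul]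
    exact centralBinom_sq_mul_le j
  · have h2 : (j + 1).centralBinom = 2 * (2 * j + 1).choose j := by
      rw [Nat.centralBinom, show 2 * (j + 1) = 2 * j + 1 + 1 by ring, Nat.choose_succ_succ,
        Nat.choose_symm_half, ← two_mul]
    have h := centralBinom_sq_mul_le (j + 1)
    rw [h2] at h
    rw [show (2 * j + 1) / 2 = j by omega]
    have e : 16 ^ (j + 1) = 4 * 4 ^ (2 * j + 1) := by
      rw [show (16 : ℕ) = 4 ^ 2 by norm_num, ← pow_mul]; ring
    rw [e] at h
    nlinarith

/-- The Erdős–Littlewood–Offord theorem: few subset sums of nonzero integers coincide. -/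
theorem card_filter_sum_eq_le {ι : Type*} [Fintype ι] [DecidableEq ι] (v : ι → ℤ)
    (hv : ∀ i, v i ≠ 0) (c : ℤ) :
    #{T : Finset ι | ∑ i ∈ T, v i = c} ≤
      (Fintype.card ι).choose (Fintype.card ι / 2) := by
  set M : Finset ι := {i | v i < 0} with hM
  have hval : ∀ T : Finset ι, ∑ i ∈ symmDiff T M, |v i| = ∑ i ∈ T, v i - ∑ i ∈ M, v i := by
    intro T
    rw [← sum_sdiff_sub_sum_sdiff, symmDiff_def, sup_eq_union,
      sum_union disjoint_sdiff_sdiff, sub_eq_add_neg, ← sum_neg_distrib]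
    congr 1
    · refine sum_congr rfl fun i hi => abs_of_nonneg ?_
      simpa [hM] using (mem_sdiff.1 hi).2
    · refine sum_congr rfl fun i hi => abs_of_neg ?_
      simpa [hM] using (mem_sdiff.1 hi).1
  rw [← card_image_of_injective _ (symmDiff_left_injective M)]
  refine IsAntichain.sperner ?_
  intro S hS S' hS' hne hsub
  obtain ⟨T, hT, rfl⟩ := mem_image.1 (mem_coe.1 hS)
  obtain ⟨T', hT', rfl⟩ := mem_image.1 (mem_coe.1 hS')
  obtain ⟨i, hi', hi⟩ := exists_of_ssubset (hsub.ssubset_of_ne hne)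
  have hlt := sum_lt_sum_of_subset (f := fun i => |v i|) hsub hi' hi (abs_pos.2 (hv i))
    fun j _ _ => abs_nonneg _
  simp only [hval, (mem_filter.1 hT).2, (mem_filter.1 hT').2, lt_irrefl] at hlt

/-- The Littlewood–Offord bound for linear equations in base-`b` digits. -/
theorem card_filter_digit_sum_eq_le {ι : Type*} [Fintype ι] [DecidableEq ι] {b : ℕ} (hb : 2 ≤ b)
    (w : ι → ℤ) (c : ℤ) :
    #{a : ι → Fin b | ∑ i, w i * (a i : ℤ) = c} * 2 ^ #{i | w i ≠ 0} ≤
      b ^ Fintype.card ι * (#{i | w i ≠ 0}).choose (#{i | w i ≠ 0} / 2) := by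
  have : NeZero b := ⟨by omega⟩
  have hone : (1 : Fin b) ≠ 0 := by
    intro h
    have := congrArg Fin.val h
    simp [Nat.mod_eq_of_lt (show 1 < b by omega)] at this
  let J := {i // w i ≠ 0}
  have hJ : Fintype.card J = #{i | w i ≠ 0} := Fintype.card_subtype _
  let P : (ι → Fin b) → Prop := fun a => ∑ i, w i * (a i : ℤ) = c
  let e : Finset J → ι → Fin b := fun T i =>
    if i ∈ T.map (Function.Embedding.subtype _) then 1 else 0
  have hfib : ∀ X : ι → Fin b, #{T : Finset J | P (X + e T)} ≤
      (Fintype.card J).choose (Fintype.card J / 2) := by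
    intro X
    let v : ι → ℤ := fun i => w i * (((X i + 1 : Fin b) : ℤ) - (X i : ℤ))
    have hv : ∀ j : J, v j ≠ 0 := fun j => by
      refine mul_ne_zero j.2 (sub_ne_zero.2 fun h => hone ?_)
      have h' : X j + 1 = X j := Fin.ext (by exact_mod_cast h)
      simpa using h'
    refine le_trans (card_le_card ?_) (card_filter_sum_eq_le (fun j : J => v j) hv
      (c - ∑ i, w i * (X i : ℤ)))
    intro T hT
    simp only [mem_filter, mem_univ, true_and, P] at hT ⊢
    have hsum : ∑ i, w i * ((X + e T) i : ℤ) = ∑ i, w i * (X i : ℤ) + ∑ j ∈ T, v j := by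
      have hmap : ∑ j ∈ T, v j = ∑ i ∈ T.map (Function.Embedding.subtype _), v i := by
        rw [sum_map]; rfl
      rw [hmap, ← univ_inter (T.map _), ← sum_ite_mem, ← sum_add_distrib]
      refine sum_congr rfl fun i _ => ?_
      simp only [Pi.add_apply, e, v]
      split_ifs
      · ring
      · simp
    rw [← hT, hsum]
    ring
  calc #{a : ι → Fin b | P a} * 2 ^ #{i | w i ≠ 0}
      = ∑ T : Finset J, #{X : ι → Fin b | P (X + e T)} := by
        rw [← hJ, ← Fintype.card_finset, mul_comm, ← smul_eq_mul, ← card_univ, ← sum_const]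
        refine sum_congr rfl fun T _ => (card_equiv (Equiv.addRight (e T)) fun X => ?_).symm
        simp
    _ = ∑ X : ι → Fin b, #{T : Finset J | P (X + e T)} := by
        simp only [card_filter]
        exact sum_comm
    _ ≤ ∑ _X : ι → Fin b, (Fintype.card J).choose (Fintype.card J / 2) :=
        sum_le_sum fun X _ => hfib X
    _ = _ := by simp [hJ]

/-! ### Counting digit strings of Keith numbers -/

theorem card_filter_two_mul_sum_lt_le {b n : ℕ} (hb : 4 ≤ b) (hn : 0 < n) :
    (#{a : Fin n → Fin b | 2 * ∑ i, (a i : ℕ) < n} : ℝ) ≤ b ^ n / √n := by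
  set A : Finset (Fin n → Fin b) := {a | 2 * ∑ i, (a i : ℕ) < n} with hA
  have hn' : (0 : ℝ) < n := by exact_mod_cast hn
  have hgeom : ∑ d : Fin b, (1 / 4 : ℝ) ^ (d : ℕ) ≤ 4 / 3 := by
    rw [Fin.sum_univ_eq_sum_range (fun d => (1 / 4 : ℝ) ^ d), geom_sum_eq (by norm_num),
      div_le_iff_of_neg (by norm_num)]
    have : (0 : ℝ) < (1 / 4) ^ b := by positivity
    linarith
  have h1 : (#A : ℝ) * (1 / 2) ^ n ≤ (4 / 3) ^ n := by
    calc (#A : ℝ) * (1 / 2) ^ n = ∑ _a ∈ A, (1 / 2 : ℝ) ^ n := by simp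
      _ ≤ ∑ a ∈ A, ∏ i, (1 / 4 : ℝ) ^ (a i : ℕ) := by
        refine sum_le_sum fun a ha => ?_
        have h4 : (1 / 4 : ℝ) = (1 / 2) ^ 2 := by norm_num
        rw [prod_pow_eq_pow_sum, h4, ← pow_mul]
        exact pow_le_pow_of_le_one (by norm_num) (by norm_num) (mem_filter.1 ha).2.le
      _ ≤ ∑ a : Fin n → Fin b, ∏ i, (1 / 4 : ℝ) ^ (a i : ℕ) :=
        sum_le_univ_sum_of_nonneg fun a => by positivity
      _ = (∑ d : Fin b, (1 / 4 : ℝ) ^ (d : ℕ)) ^ n :=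
        (Fintype.sum_pow (fun d : Fin b => (1 / 4 : ℝ) ^ (d : ℕ)) n).symm
      _ ≤ (4 / 3) ^ n := pow_le_pow_left₀ (by positivity) hgeom n
  have h2 : √n ≤ (3 / 2 : ℝ) ^ n := by
    rw [Real.sqrt_le_left (by positivity), ← pow_mul, mul_comm, pow_mul]
    calc (n : ℝ) ≤ 2 ^ n := by exact_mod_cast Nat.lt_two_pow_self.le
      _ ≤ _ := pow_le_pow_left₀ (by norm_num) (by norm_num) n
  rw [le_div_iff₀ (Real.sqrt_pos.2 hn')]
  calc (#A : ℝ) * √n ≤ #A * (3 / 2) ^ n := by gcongr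
    _ = #A * (1 / 2) ^ n * 3 ^ n := by
      rw [mul_assoc, ← mul_pow]; norm_num
    _ ≤ (4 / 3) ^ n * 3 ^ n := by gcongr
    _ = 4 ^ n := by rw [← mul_pow]; norm_num
    _ ≤ b ^ n := by gcongr; exact_mod_cast hb

theorem card_filter_nacci_eq_le {b n m : ℕ} (hb : 2 ≤ b) (hn : 2 ≤ n) (hm : n ≤ m) :
    (#{a : Fin n → Fin b | ∑ i, (a i : ℕ) * nacciBasis n i m =
      ∑ i, (a i : ℕ) * b ^ (n - 1 - i)} : ℝ) ≤ b ^ n / √n := by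
  let w : Fin n → ℤ := fun i => b ^ (n - 1 - (i : ℕ)) - nacciBasis n i m
  have hw : StrictAnti w := by
    intro i j hij
    have h1 : nacciBasis n i m ≤ nacciBasis n j m := nacciBasis_mono hij.le j.2 hm
    have h2 : b ^ (n - 1 - (j : ℕ)) < b ^ (n - 1 - (i : ℕ)) :=
      Nat.pow_lt_pow_right (by omega) (by have := Fin.lt_def.1 hij; omega)
    simp only [w]
    zify at h1 h2
    linarith
  set k := #{i | w i ≠ 0} with hk
  have hkn : n ≤ k + 1 := by
    have h1 : #{i | w i = 0} ≤ 1 := card_le_one.2 fun i hi j hj =>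
      hw.injective ((mem_filter.1 hi).2.trans (mem_filter.1 hj).2.symm)
    have h2 := card_filter_add_card_filter_not (s := (univ : Finset (Fin n))) (fun i => w i = 0)
    rw [card_univ, Fintype.card_fin] at h2
    simp only [ne_eq] at hk
    omega
  have hset : #{a : Fin n → Fin b | ∑ i, (a i : ℕ) * nacciBasis n i m =
      ∑ i, (a i : ℕ) * b ^ (n - 1 - i)} ≤ #{a : Fin n → Fin b | ∑ i, w i * (a i : ℤ) = 0} := by
    refine card_le_card fun a ha => ?_
    simp only [mem_filter, mem_univ, true_and] at ha ⊢
    zify at ha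
    have hi : ∀ i, w i * (a i : ℤ) =
        (a i : ℤ) * b ^ (n - 1 - (i : ℕ)) - (a i : ℤ) * nacciBasis n i m := fun i => by
      simp only [w]; ring
    simp only [hi, sum_sub_distrib, ha, sub_self]
  have hLO := card_filter_digit_sum_eq_le hb w 0
  rw [← hk, Fintype.card_fin] at hLO
  have hn' : (0 : ℝ) < n := by exact_mod_cast (by omega : 0 < n)
  have hchoose : (k.choose (k / 2) : ℝ) * √n ≤ 2 ^ k := by
    refine le_of_sq_le_sq ?_ (by positivity)
    rw [mul_pow, Real.sq_sqrt hn'.le, ← pow_mul, mul_comm k, pow_mul]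
    have := (Nat.mul_le_mul_left _ hkn).trans (choose_half_sq_mul_le k)
    norm_num
    exact_mod_cast this
  rw [le_div_iff₀ (Real.sqrt_pos.2 hn')]
  refine le_of_mul_le_mul_right ?_ (show (0 : ℝ) < 2 ^ k by positivity)
  have h3 := (Nat.mul_le_mul_right (2 ^ k) hset).trans hLO
  have h4 : (#{a : Fin n → Fin b | ∑ i, (a i : ℕ) * nacciBasis n i m =
      ∑ i, (a i : ℕ) * b ^ (n - 1 - i)} : ℝ) * 2 ^ k ≤ b ^ n * k.choose (k / 2) := by
    exact_mod_cast h3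
  calc _ = (#{a : Fin n → Fin b | ∑ i, (a i : ℕ) * nacciBasis n i m =
      ∑ i, (a i : ℕ) * b ^ (n - 1 - i)} : ℝ) * 2 ^ k * √n := by ring
    _ ≤ b ^ n * k.choose (k / 2) * √n := by gcongr
    _ = b ^ n * (k.choose (k / 2) * √n) := by ring
    _ ≤ b ^ n * 2 ^ k := by gcongr

theorem ofDigits_lt_pow {b n : ℕ} (hb : 0 < b) (a : Fin n → Fin b) :
    ∑ i, (a i : ℕ) * b ^ (n - 1 - i) < b ^ n := by
  have h1 : ∑ i, (a i : ℕ) * b ^ (n - 1 - i) ≤ ∑ i : Fin n, (b - 1) * b ^ (n - 1 - i) :=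
    sum_le_sum fun i _ => Nat.mul_le_mul_right _ (by have := (a i).2; omega)
  have h2 : ∑ i : Fin n, (b - 1) * b ^ (n - 1 - i) = b ^ n - 1 := by
    rw [Fin.sum_univ_eq_sum_range (fun i => (b - 1) * b ^ (n - 1 - i)), ← mul_sum,
      sum_range_reflect (fun i => b ^ i), mul_comm,
      geom_sum_mul_of_one_le hb]
  have := Nat.pow_pos (n := n) hb
  omega

/-- The indices at which a base-`b` Keith number of `n` digits with digit sum at least `n / 2` can
occur in its own sequence lie in an interval of bounded length. -/
theorem exists_index_window {b n : ℕ} (hb : 2 ≤ b) (hn : 2 ≤ n) :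
    ∃ p, n ≤ p ∧ ∀ (a : Fin n → Fin b) (m : ℕ), n ≤ m → n ≤ 2 * ∑ i, (a i : ℕ) →
      b ^ (n - 1) ≤ ∑ i, (a i : ℕ) * b ^ (n - 1 - i) →
      ∑ i, (a i : ℕ) * nacciBasis n i m = ∑ i, (a i : ℕ) * b ^ (n - 1 - i) →
      p ≤ m ∧ m < p + 8 * b ^ 2 := by
  classical
  have hlow : ∀ (a : Fin n → Fin b) (m : ℕ), n ≤ m →
      b ^ (n - 1) ≤ ∑ i, (a i : ℕ) * nacciBasis n i m →
      b ^ (n - 1) ≤ 2 * b * n * nacciBasis n 0 m := by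
    intro a m hm h
    refine h.trans ?_
    calc ∑ i, (a i : ℕ) * nacciBasis n i m ≤ ∑ _i : Fin n, b * (2 * nacciBasis n 0 m) :=
          sum_le_sum fun i _ => Nat.mul_le_mul (a i).2.le (nacciBasis_le_two_mul hn i.2 hm)
      _ = 2 * b * n * nacciBasis n 0 m := by simp; ring
  by_cases hex : ∃ m, n ≤ m ∧ b ^ (n - 1) ≤ 2 * b * n * nacciBasis n 0 m
  · obtain ⟨hp, hpow⟩ := Nat.find_spec hex
    refine ⟨Nat.find hex, hp, fun a m hm hs hN hK => ⟨?_, ?_⟩⟩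
    · exact Nat.find_min' hex ⟨hm, hlow a m hm (hK ▸ hN)⟩
    · by_contra! hlt
      set p := Nat.find hex
      have h1 := (isNacci_nacciBasis n 0).two_pow_mul_le hn hp (4 * b ^ 2)
      have h2 : nacciBasis n 0 (p + 2 * (4 * b ^ 2)) ≤ nacciBasis n 0 m :=
        (isNacci_nacciBasis n 0).le_of_le hn (by omega) (by omega)
      have h3 : (∑ i, (a i : ℕ)) * nacciBasis n 0 m < b ^ n := by
        refine lt_of_le_of_lt ?_ (ofDigits_lt_pow (by omega) a)
        rw [← hK, sum_mul]
        exact sum_le_sum fun i _ => Nat.mul_le_mul_left _ (nacciBasis_mono (Nat.zero_le _) i.2 hm)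
      have h4 : n * nacciBasis n 0 m < 2 * b ^ n := by nlinarith
      have h5 : 4 * b ^ 2 * nacciBasis n 0 p ≤ nacciBasis n 0 m :=
        (Nat.mul_le_mul_right _ Nat.lt_two_pow_self.le).trans (h1.trans h2)
      have h6 : b ^ n = b * b ^ (n - 1) := by rw [← pow_succ', Nat.sub_add_cancel (by omega)]
      have h7 := Nat.mul_le_mul_left n h5
      have h8 := Nat.mul_le_mul_left (2 * b) hpow
      have h9 : 2 * b * (2 * b * n * nacciBasis n 0 p) =
        n * (4 * b ^ 2 * nacciBasis n 0 p) := by ring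
      rw [h9] at h8
      rw [h6] at h4
      linarith
  · exact ⟨n, le_rfl, fun a m hm _ hN hK => (hex ⟨m, hm, hlow a m hm (hK ▸ hN)⟩).elim⟩

open Classical in
theorem card_filter_keith_digits_le {b n : ℕ} (hb : 4 ≤ b) (hn : 2 ≤ n) :
    (#{a : Fin n → Fin b | b ^ (n - 1) ≤ ∑ i, (a i : ℕ) * b ^ (n - 1 - i) ∧
      ∃ m, n ≤ m ∧ ∑ i, (a i : ℕ) * nacciBasis n i m =
        ∑ i, (a i : ℕ) * b ^ (n - 1 - i)} : ℝ) ≤ (8 * b ^ 2 + 1) * (b ^ n / √n) := by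
  obtain ⟨p, hp, hwin⟩ := exists_index_window (b := b) (by omega) hn
  let E : ℕ → Finset (Fin n → Fin b) := fun m => {a | ∑ i, (a i : ℕ) * nacciBasis n i m =
    ∑ i, (a i : ℕ) * b ^ (n - 1 - i)}
  let A : Finset (Fin n → Fin b) := {a | 2 * ∑ i, (a i : ℕ) < n}
  have hsub : ({a : Fin n → Fin b | b ^ (n - 1) ≤ ∑ i, (a i : ℕ) * b ^ (n - 1 - i) ∧
      ∃ m, n ≤ m ∧ ∑ i, (a i : ℕ) * nacciBasis n i m =
        ∑ i, (a i : ℕ) * b ^ (n - 1 - i)} : Finset _) ⊆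
      (range (8 * b ^ 2)).biUnion (fun d => E (p + d)) ∪ A := by
    intro a ha
    obtain ⟨hN, m, hm, hK⟩ := (mem_filter.1 ha).2
    rw [mem_union, mem_biUnion]
    rcases lt_or_ge (2 * ∑ i, (a i : ℕ)) n with hs | hs
    · exact Or.inr (mem_filter.2 ⟨mem_univ _, hs⟩)
    · obtain ⟨h1, h2⟩ := hwin a m hm hs hN hK
      refine Or.inl ⟨m - p, mem_range.2 (by omega), mem_filter.2 ⟨mem_univ _, ?_⟩⟩
      rwa [Nat.add_sub_cancel' h1]
  have hcard := (card_le_card hsub).trans ((card_union_le _ _).trans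
    (Nat.add_le_add_right card_biUnion_le _))
  refine (Nat.cast_le (α := ℝ).2 hcard).trans ?_
  push_cast
  calc ∑ d ∈ range (8 * b ^ 2), (#(E (p + d)) : ℝ) + #A
      ≤ ∑ _d ∈ range (8 * b ^ 2), (b ^ n / √n : ℝ) + b ^ n / √n :=
        add_le_add (sum_le_sum fun d _ => card_filter_nacci_eq_le (by omega) hn (by omega))
          (card_filter_two_mul_sum_lt_le hb (by omega))
    _ = _ := by
        rw [sum_const, card_range, nsmul_eq_mul]
        push_cast
        ring

/-! ### Counting Keith numbers -/

theorem ofDigits_reverse_eq_sum (b : ℕ) (l : List ℕ) :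
    Nat.ofDigits b l.reverse = ∑ i : Fin l.length, l.getD i 0 * b ^ (l.length - 1 - i) := by
  induction l with
  | nil => simp
  | cons x l ih =>
    rw [List.reverse_cons, Nat.ofDigits_append, ih, Nat.ofDigits_singleton, List.length_reverse]
    simp only [List.length_cons]
    rw [Fin.sum_univ_succ, add_comm]
    congr 1
    · simp [mul_comm]
    · refine sum_congr rfl fun i _ => ?_
      simp only [Fin.val_succ, List.getD_cons_succ]
      congr 2
      omega

theorem IsKeithBase.exists_digits {b N : ℕ} (hb : 2 ≤ b) (h : IsKeithBase b N) :
    ∃ a : Fin (b.digits N).length → Fin b,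
      ∑ i, (a i : ℕ) * b ^ ((b.digits N).length - 1 - i) = N ∧
      b ^ ((b.digits N).length - 1) ≤ N ∧
      ∃ m, (b.digits N).length ≤ m ∧
        ∑ i, (a i : ℕ) * nacciBasis (b.digits N).length i m = N := by
  obtain ⟨hlen, m, hm, hK⟩ := h
  have hN0 : N ≠ 0 := by rintro rfl; simp at hlen
  have hpow : b ^ ((b.digits N).length - 1) ≤ N := by
    have h := Nat.base_pow_length_digits_le b N (by omega) hN0
    rw [← Nat.sub_add_cancel (show 1 ≤ (b.digits N).length by omega), pow_succ'] at h
    exact Nat.le_of_mul_le_mul_left h (by omega)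
  set l := (b.digits N).reverse with hl
  have hll : (b.digits N).length = l.length := by simp [hl]
  have hlt : ∀ i, l.getD i 0 < b := by
    intro i
    rcases lt_or_ge i l.length with hi | hi
    · rw [List.getD_eq_getElem _ _ hi]
      exact Nat.digits_lt_base (m := N) (by omega) (List.mem_reverse.1 (List.getElem_mem hi))
    · rw [List.getD_eq_default _ _ hi]
      omega
  rw [hll] at hlen hpow ⊢
  refine ⟨fun i => ⟨l.getD i 0, hlt i⟩, ?_, hpow, m - 1, ?_, ?_⟩
  · rw [← ofDigits_reverse_eq_sum, hl, List.reverse_reverse, Nat.ofDigits_digits]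
  · by_contra! hlow
    rw [← Nat.sub_add_cancel hm, keithSeq_succ, if_pos hlow] at hK
    have h1 := hlt (m - 1)
    have h2 : b ^ 1 ≤ b ^ (l.length - 1) := Nat.pow_le_pow_right (by omega) (by omega)
    rw [pow_one] at h2
    omega
  · rw [← keithSeq_eq_sum, Nat.sub_add_cancel hm, hK]

theorem sum_pow_div_sqrt_le {b L : ℕ} (hb : 4 ≤ b) (hL : 1 ≤ L) :
    ∑ n ∈ Icc 2 L, (b ^ n / √n : ℝ) ≤ 4 * (b ^ L / √L) := by
  induction L, hL using Nat.le_induction with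
  | base => simp
  | succ L hL ih =>
    rw [sum_Icc_succ_top (by omega)]
    have hL' : (0 : ℝ) < L := by exact_mod_cast hL
    have hb' : (4 : ℝ) ≤ b := by exact_mod_cast hb
    have hs : 0 < √(L : ℝ) := Real.sqrt_pos.2 hL'
    have hs' : 0 < √((L + 1 : ℕ) : ℝ) := Real.sqrt_pos.2 (by positivity)
    have hle : √((L + 1 : ℕ) : ℝ) ≤ 2 * √L := by
      rw [Real.sqrt_le_left (by positivity), mul_pow, Real.sq_sqrt hL'.le]
      have : (1 : ℝ) ≤ L := by exact_mod_cast hL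
      push_cast
      linarith
    have key : 4 * ((b : ℝ) ^ L / √L) ≤ 3 * (b ^ (L + 1) / √((L + 1 : ℕ) : ℝ)) := by
      rw [mul_div_assoc', mul_div_assoc', div_le_div_iff₀ hs hs', pow_succ]
      have hp : (0 : ℝ) < (b : ℝ) ^ L := by positivity
      calc 4 * (b : ℝ) ^ L * √((L + 1 : ℕ) : ℝ) ≤ 4 * (b : ℝ) ^ L * (2 * √L) := by gcongr
        _ = (8 : ℝ) * ((b : ℝ) ^ L * √L) := by ring
        _ ≤ (3 * b) * ((b : ℝ) ^ L * √L) := by gcongr; linarith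
        _ = _ := by ring
    linarith

/-- For every b ≥ 4, the number of base-b Keith numbers in [1, x] is O_b(x/√(log x)). -/
theorem keith_count_base (b : ℕ) (hb : 4 ≤ b) :
    ∃ C : ℝ, 0 < C ∧ ∀ x : ℕ, 2 ≤ x →
      ({N : ℕ | 1 ≤ N ∧ N ≤ x ∧ IsKeithBase b N}.ncard : ℝ)
        ≤ C * x / Real.sqrt (Real.log x) := by
  classical
  have hb1 : (1 : ℝ) < b := by exact_mod_cast (by omega : 1 < b)
  have hlogb : 0 < Real.log b := Real.log_pos hb1
  refine ⟨(8 * b ^ 2 + 1) * (4 * (b * √(Real.log b))), by positivity, fun x hx => ?_⟩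
  set L := (b.digits x).length with hL
  have hx0 : (0 : ℝ) < x := by exact_mod_cast (by omega : 0 < x)
  have hlogx : 0 < Real.log x := Real.log_pos (by exact_mod_cast (by omega : 1 < x))
  have hxL : x < b ^ L := Nat.lt_base_pow_length_digits (by omega)
  have hLx : b ^ L ≤ b * x := Nat.base_pow_length_digits_le b x (by omega) (by omega)
  have hL1 : 1 ≤ L := by
    by_contra! h
    rw [Nat.lt_one_iff.1 h, pow_zero] at hxL
    omega
  let D : (n : ℕ) → Finset (Fin n → Fin b) := fun n =>
    {a | b ^ (n - 1) ≤ ∑ i, (a i : ℕ) * b ^ (n - 1 - i) ∧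
      ∃ m, n ≤ m ∧ ∑ i, (a i : ℕ) * nacciBasis n i m = ∑ i, (a i : ℕ) * b ^ (n - 1 - i)}
  let B : ℕ → Finset ℕ := fun n => (D n).image fun a => ∑ i : Fin n, (a i : ℕ) * b ^ (n - 1 - i)
  have hsub : {N : ℕ | 1 ≤ N ∧ N ≤ x ∧ IsKeithBase b N} ⊆ ((Icc 2 L).biUnion B : Finset ℕ) := by
    rintro N ⟨-, hNx, hN⟩
    obtain ⟨a, ha, hpow, m, hm, hK⟩ := hN.exists_digits (by omega)
    refine mem_coe.2 (mem_biUnion.2 ⟨_, mem_Icc.2 ⟨hN.1, Nat.le_length_digits_le b N x hNx⟩,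
      mem_image.2 ⟨a, mem_filter.2 ⟨mem_univ _, ?_, m, hm, ?_⟩, ha⟩⟩)
    · rwa [ha]
    · rw [ha, hK]
  have hcard : {N : ℕ | 1 ≤ N ∧ N ≤ x ∧ IsKeithBase b N}.ncard ≤ ∑ n ∈ Icc 2 L, #(D n) := by
    refine (Set.ncard_le_ncard hsub (finite_toSet _)).trans ?_
    rw [Set.ncard_coe_finset]
    exact card_biUnion_le.trans (sum_le_sum fun n _ => card_image_le)
  have hsqrt : √(Real.log x) ≤ √(Real.log b) * √L := by
    rw [← Real.sqrt_mul hlogb.le]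
    refine Real.sqrt_le_sqrt ?_
    rw [mul_comm, ← Real.log_pow]
    exact Real.log_le_log hx0 (by exact_mod_cast hxL.le)
  have hLs : 0 < √(L : ℝ) := Real.sqrt_pos.2 (by exact_mod_cast hL1)
  calc ({N : ℕ | 1 ≤ N ∧ N ≤ x ∧ IsKeithBase b N}.ncard : ℝ)
      ≤ ∑ n ∈ Icc 2 L, (#(D n) : ℝ) := by exact_mod_cast hcard
    _ ≤ ∑ n ∈ Icc 2 L, (8 * b ^ 2 + 1) * (b ^ n / √n : ℝ) :=
      sum_le_sum fun n hn => card_filter_keith_digits_le hb (mem_Icc.1 hn).1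
    _ = (8 * b ^ 2 + 1) * ∑ n ∈ Icc 2 L, (b ^ n / √n : ℝ) := (mul_sum _ _ _).symm
    _ ≤ (8 * b ^ 2 + 1) * (4 * (b ^ L / √L)) := by
      gcongr
      exact sum_pow_div_sqrt_le hb hL1
    _ ≤ (8 * b ^ 2 + 1) * (4 * (b * x * √(Real.log b) / √(Real.log x))) := by
      gcongr _ * (4 * ?_)
      rw [div_le_div_iff₀ hLs (Real.sqrt_pos.2 hlogx)]
      calc (b : ℝ) ^ L * √(Real.log x) ≤ (b * x) * (√(Real.log b) * √L) := by
            gcongr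
            exact_mod_cast hLx
        _ = _ := by ring
    _ = _ := by ring
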